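/- There exist C, c > 0 and h₀ > 0 such that for every h ∈ (0,h₀) and every E₀ ∈ ℝ with |E₀ − (1+h)| ≤ e^{−1/(10h)}, there exists w ∈ C^∞([2,3.5];ℂ) satisfying: −h²w'' + (4 − x − E₀)w = 0 on [2,3.5]; ‖w‖_{H¹_h(2,2.5)} ≤ C e^{−c/h}; and for all x ∈ [3.25, 3.5], |w(x) − (e^{iπ/4}v₊(x) − e^{−iπ/4}v₋(x))| ≤ C h and |h w'(x) − (e^{iπ/4}·h v₊'(x) − e^{−iπ/4}·h v₋'(x))| ≤ C h. -/

import Mathlib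

open MeasureTheory Set Real

noncomputable section

/-- The phase `Φ(x) = ∫_{4-E₀}^x √(E₀ - V(y)) dy`. -/
def wkbPhase (V : ℝ → ℝ) (E₀ : ℝ) (x : ℝ) : ℝ :=
  ∫ y in (4 - E₀)..x, Real.sqrt (E₀ - V y)

/-- The WKB solution `v₊(x) = (E₀ - V(x))^{-1/4} e^{iΦ(x)/h}`. -/
def wkbPlus (V : ℝ → ℝ) (h E₀ : ℝ) (x : ℝ) : ℂ :=
  (((E₀ - V x) ^ (-(1 / 4 : ℝ)) : ℝ) : ℂ) * Complex.exp (Complex.I * (wkbPhase V E₀ x) / h)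

/-- The WKB solution `v₋(x) = (E₀ - V(x))^{-1/4} e^{-iΦ(x)/h}`. -/
def wkbMinus (V : ℝ → ℝ) (h E₀ : ℝ) (x : ℝ) : ℂ :=
  (((E₀ - V x) ^ (-(1 / 4 : ℝ)) : ℝ) : ℂ) * Complex.exp (-Complex.I * (wkbPhase V E₀ x) / h)


def aiE (h : ℝ) (z t : ℂ) : ℂ := Complex.exp ((t ^ 3 / 3 - z * t) / h)

def aiI (k : ℕ) (h : ℝ) (c z : ℂ) : ℂ :=
  ∫ u : ℝ, (c + Complex.I * u) ^ k * aiE h z (c + Complex.I * u)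

lemma aiE_norm (h : ℝ) (z c : ℂ) (u : ℝ) :
    ‖aiE h z (c + Complex.I * u)‖ = Real.exp ((c.re ^ 3 / 3 - c.re * (c.im + u) ^ 2
      - z.re * c.re + z.im * (c.im + u)) / h) := by
  unfold aiE
  rw [Complex.norm_exp, Complex.div_ofReal_re]
  congr 2
  have h3 : ∀ w : ℂ, w / 3 = w / ((3 : ℝ) : ℂ) := by intro w; norm_num
  rw [h3, Complex.sub_re, Complex.div_ofReal_re]
  simp [pow_succ, Complex.mul_re, Complex.mul_im]
  ring

lemma aiI_bound (k : ℕ) (h α M : ℝ) (hh : 0 < h) (hα : 0 < α) (hM : 0 ≤ M) :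
    ∃ K β : ℝ, 0 < β ∧ ∀ c z : ℂ, α ≤ c.re → ‖c‖ ≤ M → ‖z‖ ≤ M → ∀ u : ℝ,
      ‖(c + Complex.I * u) ^ k * aiE h z (c + Complex.I * u)‖ ≤ K * Real.exp (-β * u ^ 2) := by
  set β : ℝ := α / (8 * h) with hβ
  have hβ0 : 0 < β := by positivity
  refine ⟨k.factorial * Real.exp (M + 1 / (4 * β) + (M ^ 3 / 3 + M ^ 2 + M ^ 2 / (2 * α) + α / 2 * M ^ 2) / h), β, hβ0, ?_⟩
  intro c z hc hcM hzM u
  rw [norm_mul, norm_pow, aiE_norm]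
  have h1 : ‖c + Complex.I * u‖ ^ k ≤ k.factorial * Real.exp (M + |u|) := by
    have h2 : ‖c + Complex.I * u‖ ≤ M + |u| := by
      refine (norm_add_le _ _).trans ?_
      simpa using hcM
    have h3 : ‖c + Complex.I * u‖ ^ k ≤ (M + |u|) ^ k := by gcongr
    have h4 := Real.pow_div_factorial_le_exp (M + |u|) (by positivity) k
    rw [div_le_iff₀ (by positivity)] at h4
    linarith
  have hre : |c.re| ≤ M := (Complex.abs_re_le_norm c).trans hcM
  have him : |c.im| ≤ M := (Complex.abs_im_le_norm c).trans hcM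
  have zre : |z.re| ≤ M := (Complex.abs_re_le_norm z).trans hzM
  have zim : |z.im| ≤ M := (Complex.abs_im_le_norm z).trans hzM
  have hu : |u| ≤ β * u ^ 2 + 1 / (4 * β) := by
    have : 0 ≤ (2 * β * |u| - 1) ^ 2 / (4 * β) := by positivity
    have e : (2 * β * |u| - 1) ^ 2 / (4 * β) = β * |u| ^ 2 + 1 / (4 * β) - |u| := by
      field_simp; ring
    rw [e, sq_abs] at this
    linarith
  have hexp : (c.re ^ 3 / 3 - c.re * (c.im + u) ^ 2 - z.re * c.re + z.im * (c.im + u))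
      ≤ (M ^ 3 / 3 + M ^ 2 + M ^ 2 / (2 * α) + α / 2 * M ^ 2) - α / 4 * u ^ 2 := by
    have a1 : c.re ^ 3 ≤ M ^ 3 := by
      have : c.re ≤ M := (le_abs_self _).trans hre
      have : 0 ≤ c.re := by linarith
      gcongr
    have a2 : -(z.re * c.re) ≤ M ^ 2 := by
      have : |z.re * c.re| ≤ M * M := by rw [abs_mul]; gcongr
      have := neg_abs_le (z.re * c.re)
      nlinarith
    have a3 : z.im * (c.im + u) ≤ M ^ 2 / (2 * α) + α / 2 * (c.im + u) ^ 2 := by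
      have b1 : z.im * (c.im + u) ≤ M * |c.im + u| := by
        refine (le_abs_self _).trans ?_
        rw [abs_mul]; gcongr
      have : 0 ≤ (M - α * |c.im + u|) ^ 2 / (2 * α) := by positivity
      have e : (M - α * |c.im + u|) ^ 2 / (2 * α)
        = M ^ 2 / (2 * α) + α / 2 * |c.im + u| ^ 2 - M * |c.im + u| := by
        field_simp; ring
      rw [e, sq_abs] at this
      linarith
    have a4 : α * (c.im + u) ^ 2 ≤ c.re * (c.im + u) ^ 2 := by gcongr
    have a5 : u ^ 2 / 2 - M ^ 2 ≤ (c.im + u) ^ 2 := by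
      have : c.im ^ 2 ≤ M ^ 2 := by rw [← sq_abs c.im]; gcongr
      nlinarith [sq_nonneg (2 * c.im + u)]
    nlinarith
  calc _ ≤ (k.factorial * Real.exp (M + |u|)) * Real.exp (((M ^ 3 / 3 + M ^ 2 + M ^ 2 / (2 * α) + α / 2 * M ^ 2) - α / 4 * u ^ 2) / h) := by gcongr
    _ = k.factorial * Real.exp (M + |u| + ((M ^ 3 / 3 + M ^ 2 + M ^ 2 / (2 * α) + α / 2 * M ^ 2) - α / 4 * u ^ 2) / h) := by
      rw [Real.exp_add (M + |u|)]; ring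
    _ ≤ k.factorial * Real.exp ((M + 1 / (4 * β) + (M ^ 3 / 3 + M ^ 2 + M ^ 2 / (2 * α) + α / 2 * M ^ 2) / h) + -β * u ^ 2) := by
      refine mul_le_mul_of_nonneg_left (Real.exp_le_exp.mpr ?_) (by positivity)
      have : α / 4 * u ^ 2 / h = 2 * β * u ^ 2 := by rw [hβ]; field_simp; ring
      rw [sub_div, this]; linarith
    _ = _ := by rw [Real.exp_add _ (-β * u ^ 2)]; ring

lemma aiI_cont (k : ℕ) (h : ℝ) (c z : ℂ) :
    Continuous fun u : ℝ => (c + Complex.I * u) ^ k * aiE h z (c + Complex.I * u) := by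
  unfold aiE; fun_prop

lemma aiI_integrable (k : ℕ) (h : ℝ) (c z : ℂ) (hh : 0 < h) (hc : 0 < c.re) :
    Integrable fun u : ℝ => (c + Complex.I * u) ^ k * aiE h z (c + Complex.I * u) := by
  obtain ⟨K, β, hβ, hb⟩ := aiI_bound k h c.re (‖c‖ + ‖z‖) hh hc (by positivity)
  refine Integrable.mono' ((integrable_exp_neg_mul_sq hβ).const_mul K)
    (aiI_cont k h c z).aestronglyMeasurable (Filter.Eventually.of_forall fun u => ?_)
  exact hb c z le_rfl (by linarith [norm_nonneg z]) (by linarith [norm_nonneg c]) u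

lemma aiE_hasDerivAt_t (h : ℝ) (z t : ℂ) :
    HasDerivAt (fun t => aiE h z t) (aiE h z t * ((t ^ 2 - z) / h)) t := by
  unfold aiE
  have : HasDerivAt (fun t : ℂ => (t ^ 3 / 3 - z * t) / h) ((t ^ 2 - z) / h) t := by
    have := ((((hasDerivAt_id t).pow 3).div_const 3).sub ((hasDerivAt_id t).const_mul z)).div_const (h : ℂ)
    refine this.congr_deriv ?_
    simp
  exact this.cexp

lemma aiE_hasDerivAt_z (h : ℝ) (z t : ℂ) :
    HasDerivAt (fun z => aiE h z t) (aiE h z t * (-t / h)) z := by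
  unfold aiE
  have : HasDerivAt (fun z : ℂ => (t ^ 3 / 3 - z * t) / h) (-t / h) z := by
    have := (((hasDerivAt_id z).mul_const t).const_sub (t ^ 3 / 3)).div_const (h : ℂ)
    refine this.congr_deriv ?_
    simp
  exact this.cexp

/-- The total derivative integrates to zero. -/
lemma aiI_two (h : ℝ) (c z : ℂ) (hh : 0 < h) (hc : 0 < c.re) :
    aiI 2 h c z = z * aiI 0 h c z := by
  have i2 := aiI_integrable 2 h c z hh hc
  have i0 := aiI_integrable 0 h c z hh hc
  have hh' : (h : ℂ) ≠ 0 := by exact_mod_cast hh.ne'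
  have key := integral_eq_zero_of_hasDerivAt_of_integrable
    (f := fun u : ℝ => aiE h z (c + Complex.I * u))
    (f' := fun u : ℝ => (Complex.I / h) * ((c + Complex.I * u) ^ 2 * aiE h z (c + Complex.I * u)
      - z * ((c + Complex.I * u) ^ 0 * aiE h z (c + Complex.I * u)))) ?_
      ((i2.sub (i0.const_mul z)).const_mul _) (by simpa using i0)
  · rw [integral_const_mul, integral_sub i2 (i0.const_mul z), integral_const_mul] at key
    have : Complex.I / (h : ℂ) ≠ 0 := div_ne_zero Complex.I_ne_zero hh'
    have := (mul_eq_zero.mp key).resolve_left this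
    exact sub_eq_zero.mp this
  · intro u
    have h1 : HasDerivAt (fun u : ℝ => c + Complex.I * (u : ℂ)) Complex.I u := by
      simpa using ((Complex.ofRealCLM.hasDerivAt (x := u)).const_mul Complex.I).const_add c
    have := (aiE_hasDerivAt_t h z (c + Complex.I * u)).comp u h1
    refine this.congr_deriv ?_
    field_simp

lemma aiI_hasDerivAt_z (k : ℕ) (h : ℝ) (c z : ℂ) (hh : 0 < h) (hc : 0 < c.re) :
    HasDerivAt (fun z => aiI k h c z) (-(1 / h) * aiI (k + 1) h c z) z := by
  obtain ⟨K, β, hβ, hb⟩ := aiI_bound (k + 1) h c.re (‖c‖ + ‖z‖ + 1) hh hc (by positivity)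
  have := hasDerivAt_integral_of_dominated_loc_of_deriv_le (μ := volume) (𝕜 := ℂ) (s := Metric.ball z 1)
    (F := fun z (u : ℝ) => (c + Complex.I * u) ^ k * aiE h z (c + Complex.I * u))
    (F' := fun z (u : ℝ) => -(1 / h) * ((c + Complex.I * u) ^ (k + 1) * aiE h z (c + Complex.I * u)))
    (bound := fun u => (1 / h) * (K * Real.exp (-β * u ^ 2))) (x₀ := z)
    (Metric.ball_mem_nhds z one_pos)
    (Filter.Eventually.of_forall fun z => (aiI_cont k h c z).aestronglyMeasurable)
    (aiI_integrable k h c z hh hc)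
    (((aiI_cont (k + 1) h c z).const_mul _).aestronglyMeasurable)
    (Filter.Eventually.of_forall fun u x hx => ?_)
    (((integrable_exp_neg_mul_sq hβ).const_mul K).const_mul _)
    (Filter.Eventually.of_forall fun u x hx => ?_)
  · have h2 := this.2
    rw [integral_const_mul] at h2
    exact h2
  · rw [norm_mul]
    have hx' : ‖x‖ ≤ ‖z‖ + 1 := by
      have := norm_sub_norm_le x z
      rw [mem_ball_iff_norm] at hx; linarith
    have := hb c x le_rfl (by linarith [norm_nonneg z]) (by linarith [norm_nonneg c]) u
    have e : ‖-(1 / (h : ℂ))‖ = 1 / h := by simp [abs_of_pos hh]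
    rw [e]
    gcongr
  · refine ((aiE_hasDerivAt_z h x (c + Complex.I * u)).const_mul _).congr_deriv ?_
    rw [pow_succ]; ring

lemma aiI_hasDerivAt_c (h : ℝ) (c z : ℂ) (hh : 0 < h) (hc : 0 < c.re) :
    HasDerivAt (fun c => aiI 0 h c z) 0 c := by
  obtain ⟨K, β, hβ, hb⟩ := aiI_bound 2 h (c.re / 2) (‖c‖ + ‖z‖ + c.re) hh (by positivity) (by positivity)
  obtain ⟨K', β', hβ', hb'⟩ := aiI_bound 0 h (c.re / 2) (‖c‖ + ‖z‖ + c.re) hh (by positivity) (by positivity)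
  have i2 := aiI_integrable 2 h c z hh hc
  have i0 := aiI_integrable 0 h c z hh hc
  have := hasDerivAt_integral_of_dominated_loc_of_deriv_le (μ := volume) (𝕜 := ℂ)
    (s := Metric.ball c (c.re / 2))
    (F := fun c (u : ℝ) => (c + Complex.I * u) ^ 0 * aiE h z (c + Complex.I * u))
    (F' := fun c (u : ℝ) => (1 / h) * ((c + Complex.I * u) ^ 2 * aiE h z (c + Complex.I * u)
      - z * ((c + Complex.I * u) ^ 0 * aiE h z (c + Complex.I * u))))
    (bound := fun u => (1 / h) * (K * Real.exp (-β * u ^ 2) + ‖z‖ * (K' * Real.exp (-β' * u ^ 2))))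
    (x₀ := c)
    (Metric.ball_mem_nhds c (by positivity))
    (Filter.Eventually.of_forall fun c => (aiI_cont 0 h c z).aestronglyMeasurable)
    i0
    ((((aiI_cont 2 h c z).sub ((aiI_cont 0 h c z).const_mul z)).const_mul _).aestronglyMeasurable)
    (Filter.Eventually.of_forall fun u x hx => ?_)
    ((((integrable_exp_neg_mul_sq hβ).const_mul K).add
      (((integrable_exp_neg_mul_sq hβ').const_mul K').const_mul _)).const_mul _)
    (Filter.Eventually.of_forall fun u x hx => ?_)
  · have h2 := this.2
    rw [integral_const_mul, integral_sub i2 (i0.const_mul z), integral_const_mul] at h2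
    have e := aiI_two h c z hh hc
    unfold aiI at e
    rw [e, sub_self, mul_zero] at h2
    exact h2
  · rw [mem_ball_iff_norm] at hx
    have hx' : ‖x‖ ≤ ‖c‖ + c.re / 2 := by
      have := norm_sub_norm_le x c
      linarith
    have hx2 : c.re / 2 ≤ x.re := by
      have := (Complex.abs_re_le_norm (x - c)).trans hx.le
      rw [Complex.sub_re, abs_le] at this
      linarith [this.1]
    have b2 := hb x z hx2 (by linarith [norm_nonneg z]) (by linarith [norm_nonneg c]) u
    have b0 := hb' x z hx2 (by linarith [norm_nonneg z]) (by linarith [norm_nonneg c]) u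
    rw [norm_mul]
    have e : ‖(1 / (h : ℂ))‖ = 1 / h := by simp [abs_of_pos hh]
    rw [e]
    refine mul_le_mul_of_nonneg_left ((norm_sub_le _ _).trans ?_) (by positivity)
    rw [norm_mul z]
    gcongr
  · have h1 : HasDerivAt (fun x : ℂ => x + Complex.I * (u : ℂ)) 1 x :=
      (hasDerivAt_id x).add_const _
    have := (aiE_hasDerivAt_t h z (x + Complex.I * u)).comp x h1
    simp only [pow_zero, one_mul]
    refine this.congr_deriv ?_
    field_simp

lemma aiI_indep (h : ℝ) (c c' z : ℂ) (hh : 0 < h) (hc : 0 < c.re) (hc' : 0 < c'.re) :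
    aiI 0 h c z = aiI 0 h c' z := by
  have hopen : IsOpen {c : ℂ | 0 < c.re} := isOpen_lt continuous_const Complex.continuous_re
  have hconv : Convex ℝ {c : ℂ | 0 < c.re} := convex_halfSpace_re_gt 0
  exact hopen.is_const_of_deriv_eq_zero hconv.isPreconnected
    (f := fun c => aiI 0 h c z)
    (fun x hx => (aiI_hasDerivAt_c h x z hh hx).differentiableAt.differentiableWithinAt)
    (fun x hx => (aiI_hasDerivAt_c h x z hh hx).deriv) hc hc'

/-- Airy-type function `A` and its semiclassical derivative. -/
def aiA (h : ℝ) (z : ℂ) : ℂ := aiI 0 h 1 z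

def aiD (h : ℝ) (z : ℂ) : ℂ := -(1 / h) * aiI 1 h 1 z

lemma aiA_hasDerivAt (h : ℝ) (z : ℂ) (hh : 0 < h) : HasDerivAt (aiA h) (aiD h z) z :=
  aiI_hasDerivAt_z 0 h 1 z hh (by simp)

lemma aiD_hasDerivAt (h : ℝ) (z : ℂ) (hh : 0 < h) : HasDerivAt (aiD h) (z * aiA h z / h ^ 2) z := by
  have := (aiI_hasDerivAt_z 1 h 1 z hh (by simp)).const_mul (-(1 / (h : ℂ)))
  refine this.congr_deriv ?_
  rw [aiI_two h 1 z hh (by simp)]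
  unfold aiA
  ring

lemma aiA_eq (h : ℝ) (c z : ℂ) (hh : 0 < h) (hc : 0 < c.re) : aiA h z = aiI 0 h c z :=
  aiI_indep h 1 c z hh (by simp) hc

lemma aiD_eq (h : ℝ) (c z : ℂ) (hh : 0 < h) (hc : 0 < c.re) :
    aiD h z = -(1 / h) * aiI 1 h c z := by
  have h1 := aiA_hasDerivAt h z hh
  have e : aiA h = fun z => aiI 0 h c z := funext fun z => aiA_eq h c z hh hc
  rw [e] at h1
  exact h1.unique (aiI_hasDerivAt_z 0 h c z hh hc)

lemma aiA_rot (h y : ℝ) (hh : 0 < h) (hy : 0 ≤ y) (ε ε' : ℂ) (e1 : ε + ε' = 1)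
    (e2 : ε ^ 2 + ε' ^ 2 = -1) (e3 : ε ^ 3 = -1) (e3' : ε' ^ 3 = -1) :
    aiA h (-y) = ε * aiA h (ε * y) + ε' * aiA h (ε' * y) ∧
    -aiD h (-y) = ε ^ 2 * aiD h (ε * y) + ε' ^ 2 * aiD h (ε' * y) := by
  have hh' : (h : ℂ) ≠ 0 := by exact_mod_cast hh.ne'
  have hA : ∀ (δ : ℂ) (t : ℝ), HasDerivAt (fun t : ℝ => aiA h (δ * t)) (δ * aiD h (δ * t)) t := by
    intro δ t
    have h1 : HasDerivAt (fun t : ℝ => δ * (t : ℂ)) δ t := by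
      simpa using ((Complex.ofRealCLM.hasDerivAt (x := t)).const_mul δ)
    have := (aiA_hasDerivAt h (δ * t) hh).comp t h1
    exact this.congr_deriv (by ring)
  have hD : ∀ (δ : ℂ) (t : ℝ), HasDerivAt (fun t : ℝ => aiD h (δ * t))
      (δ ^ 2 * t * aiA h (δ * t) / h ^ 2) t := by
    intro δ t
    have h1 : HasDerivAt (fun t : ℝ => δ * (t : ℂ)) δ t := by
      simpa using ((Complex.ofRealCLM.hasDerivAt (x := t)).const_mul δ)
    have := (aiD_hasDerivAt h (δ * t) hh).comp t h1
    exact this.congr_deriv (by ring)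
  let f : ℝ → ℂ × ℂ := fun t => (aiA h (-1 * t), -1 * aiD h (-1 * t))
  let g : ℝ → ℂ × ℂ := fun t => (ε * aiA h (ε * t) + ε' * aiA h (ε' * t),
    ε ^ 2 * aiD h (ε * t) + ε' ^ 2 * aiD h (ε' * t))
  let v : ℝ → ℂ × ℂ → ℂ × ℂ := fun t p => (p.2, -(t / h ^ 2 : ℂ) * p.1)
  have hf : ∀ t, HasDerivAt f (v t (f t)) t := by
    intro t
    refine (((hA (-1) t)).prodMk (((hD (-1) t)).const_mul (-1))).congr_deriv ?_
    simp only [v, f]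
    refine Prod.ext rfl ?_
    simp only []
    ring
  have hg : ∀ t, HasDerivAt g (v t (g t)) t := by
    intro t
    refine ((((hA ε t).const_mul ε).add ((hA ε' t).const_mul ε')).prodMk
      (((hD ε t).const_mul (ε ^ 2)).add ((hD ε' t).const_mul (ε' ^ 2)))).congr_deriv ?_
    simp only [v, g]
    refine Prod.ext ?_ ?_
    · simp only []
      ring
    · simp only []
      linear_combination (ε * t * aiA h (ε * t) / h ^ 2) * e3
        + (ε' * t * aiA h (ε' * t) / h ^ 2) * e3'
  have hL : ∀ t ∈ Ico 0 y, LipschitzOnWith (Real.toNNReal (1 + y / h ^ 2)) (v t) univ := by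
    intro t ht
    refine LipschitzOnWith.of_dist_le_mul fun p _ q _ => ?_
    rw [Real.coe_toNNReal _ (by positivity), Prod.dist_eq]
    have d1 : dist p.1 q.1 ≤ dist p q := le_max_left _ _
    have d2 : dist p.2 q.2 ≤ dist p q := le_max_right _ _
    have d0 : 0 ≤ dist p q := dist_nonneg
    have hyh : 0 ≤ y / h ^ 2 := by positivity
    refine max_le ?_ ?_
    · simp only [v]; nlinarith
    · simp only [v]
      rw [dist_eq_norm, ← mul_sub, norm_mul, ← dist_eq_norm]
      have : ‖-(t / h ^ 2 : ℂ)‖ = t / h ^ 2 := by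
        simp [abs_of_nonneg ht.1]
      rw [this]
      have : t / h ^ 2 ≤ y / h ^ 2 := by gcongr; exact ht.2.le
      have t0 : 0 ≤ t / h ^ 2 := div_nonneg ht.1 (by positivity)
      calc t / h ^ 2 * dist p.1 q.1 ≤ y / h ^ 2 * dist p q := by gcongr
        _ ≤ _ := by nlinarith
  have := ODE_solution_unique_of_mem_Icc_right hL
    (fun t _ => (hf t).continuousAt.continuousWithinAt)
    (fun t _ => (hf t).hasDerivWithinAt) (fun _ _ => mem_univ _)
    (fun t _ => (hg t).continuousAt.continuousWithinAt)
    (fun t _ => (hg t).hasDerivWithinAt) (fun _ _ => mem_univ _) (by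
      simp only [f, g]
      refine Prod.ext ?_ ?_
      · simp only [Complex.ofReal_zero, mul_zero]
        linear_combination -(aiA h 0) * e1
      · simp only [Complex.ofReal_zero, mul_zero]
        linear_combination -(aiD h 0) * e2) (right_mem_Icc.mpr hy)
  simp only [f, g, Prod.mk.injEq, neg_one_mul] at this
  exact this

lemma cexp_taylor2 (x : ℝ) : ‖Complex.exp (Complex.I * x) - 1 - Complex.I * x‖ ≤ 2 * x ^ 2 := by
  have e : ‖Complex.I * (x : ℂ)‖ = |x| := by simp
  by_cases hx : |x| ≤ 1
  · have := Complex.norm_exp_sub_one_sub_id_le (x := Complex.I * x) (by rw [e]; exact hx)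
    rw [e, sq_abs] at this
    nlinarith [sq_nonneg x]
  · push Not at hx
    have h1 : ‖Complex.exp (Complex.I * x) - 1‖ ≤ |x| := norm_exp_I_mul_ofReal_sub_one_le
    have := norm_sub_le (Complex.exp (Complex.I * x) - 1) (Complex.I * x)
    rw [e] at this
    have : |x| ≤ |x| ^ 2 := by nlinarith
    rw [sq_abs] at this
    linarith

lemma pow_gauss_le (n : ℕ) (a u : ℝ) (ha : 0 < a) :
    (u ^ 2) ^ n * Real.exp (-a * u ^ 2)
      ≤ (n.factorial * 2 ^ n / a ^ n) * Real.exp (-(a / 2) * u ^ 2) := by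
  have h1 := Real.pow_div_factorial_le_exp (a * u ^ 2 / 2) (by positivity) n
  rw [div_le_iff₀ (by positivity)] at h1
  have h2 : Real.exp (-a * u ^ 2) = Real.exp (-(a / 2) * u ^ 2) * Real.exp (-(a / 2) * u ^ 2) := by
    rw [← Real.exp_add]; ring_nf
  have h3 : Real.exp (a * u ^ 2 / 2) * Real.exp (-(a / 2) * u ^ 2) = 1 := by
    rw [← Real.exp_add]; ring_nf; simp
  have h4 : (u ^ 2) ^ n = (a * u ^ 2 / 2) ^ n * (2 ^ n / a ^ n) := by
    rw [div_pow, mul_pow]; field_simp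
  calc (u ^ 2) ^ n * Real.exp (-a * u ^ 2)
      = (a * u ^ 2 / 2) ^ n * (2 ^ n / a ^ n)
        * (Real.exp (-(a / 2) * u ^ 2) * Real.exp (-(a / 2) * u ^ 2)) := by rw [h2, ← h4]
    _ ≤ (Real.exp (a * u ^ 2 / 2) * n.factorial) * (2 ^ n / a ^ n)
        * (Real.exp (-(a / 2) * u ^ 2) * Real.exp (-(a / 2) * u ^ 2)) := by gcongr
    _ = (Real.exp (a * u ^ 2 / 2) * Real.exp (-(a / 2) * u ^ 2)) * ((n.factorial * 2 ^ n / a ^ n)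
        * Real.exp (-(a / 2) * u ^ 2)) := by ring
    _ = _ := by rw [h3, one_mul]

lemma norm_gauss (b : ℂ) (u : ℝ) :
    ‖Complex.exp (-b * (u : ℂ) ^ 2)‖ = Real.exp (-b.re * u ^ 2) := by
  rw [Complex.norm_exp]
  congr 1
  simp [pow_two, Complex.mul_re]

lemma integral_odd_zero (f : ℝ → ℂ) (hf : ∀ u, f (-u) = -f u) : ∫ u, f u = 0 := by
  have h1 := integral_neg_eq_self f volume
  simp_rw [hf] at h1
  rw [integral_neg] at h1
  have : (2 : ℂ) * ∫ u, f u = 0 := by linear_combination -h1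
  simpa using this

lemma gauss_pow_integrable (b : ℂ) (n : ℕ) (hb : 0 < b.re) :
    Integrable fun u : ℝ => (u : ℂ) ^ n * Complex.exp (-b * (u : ℂ) ^ 2) := by
  refine Integrable.mono' ((((integrable_exp_neg_mul_sq (half_pos hb)).const_mul
    (n.factorial * 2 ^ n / b.re ^ n))).add (integrable_exp_neg_mul_sq hb))
    (by fun_prop) (Filter.Eventually.of_forall fun u => ?_)
  have := pow_gauss_le n b.re u hb
  rw [norm_mul, norm_pow, norm_gauss, Complex.norm_real, Real.norm_eq_abs]
  have h2 : |u| ^ n ≤ (u ^ 2) ^ n + 1 := by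
    rw [← sq_abs u, ← pow_mul, mul_comm, pow_mul]
    nlinarith [sq_nonneg (|u| ^ n - 1), sq_nonneg (|u| ^ n)]
  have e0 := Real.exp_pos (-b.re * u ^ 2)
  simp only [Pi.add_apply]
  nlinarith

lemma gauss_err0 (b : ℂ) (l : ℝ) (hb : 0 < b.re) :
    ‖(∫ u : ℝ, Complex.exp (-b * (u : ℂ) ^ 2) * Complex.exp (Complex.I * ((-(l * u ^ 3) : ℝ) : ℂ)))
      - ∫ u : ℝ, Complex.exp (-b * (u : ℂ) ^ 2)‖
      ≤ 96 * l ^ 2 / b.re ^ 3 * √(π / (b.re / 2)) := by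
  have i0 := integrable_cexp_neg_mul_sq hb
  have i3 := gauss_pow_integrable b 3 hb
  have iE : Integrable fun u : ℝ => Complex.exp (-b * (u : ℂ) ^ 2)
      * Complex.exp (Complex.I * ((-(l * u ^ 3) : ℝ) : ℂ)) := by
    refine Integrable.mono i0 (by fun_prop) (Filter.Eventually.of_forall fun u => ?_)
    rw [norm_mul, mul_comm Complex.I, Complex.norm_exp_ofReal_mul_I, mul_one]
  have hodd : ∫ u : ℝ, (-(Complex.I * l)) * ((u : ℂ) ^ 3 * Complex.exp (-b * (u : ℂ) ^ 2)) = 0 := by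
    apply integral_odd_zero
    intro u
    push_cast
    rw [show (-(u : ℂ)) ^ 2 = (u : ℂ) ^ 2 by ring]
    ring
  have e : (∫ u : ℝ, Complex.exp (-b * (u : ℂ) ^ 2) * Complex.exp (Complex.I * ((-(l * u ^ 3) : ℝ) : ℂ)))
      - ∫ u : ℝ, Complex.exp (-b * (u : ℂ) ^ 2)
      = ∫ u : ℝ, (Complex.exp (-b * (u : ℂ) ^ 2) * Complex.exp (Complex.I * ((-(l * u ^ 3) : ℝ) : ℂ))
        - Complex.exp (-b * (u : ℂ) ^ 2)
        - (-(Complex.I * l)) * ((u : ℂ) ^ 3 * Complex.exp (-b * (u : ℂ) ^ 2))) := by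
    have h1 := integral_sub (iE.sub i0) (i3.const_mul (-(Complex.I * l)))
    simp only [Pi.sub_apply] at h1
    rw [h1, hodd, integral_sub iE i0, sub_zero]
  rw [e, ← integral_gaussian, ← integral_const_mul]
  refine norm_integral_le_of_norm_le ((integrable_exp_neg_mul_sq (half_pos hb)).const_mul _)
    (Filter.Eventually.of_forall fun u => ?_)
  have e2 : Complex.exp (-b * (u : ℂ) ^ 2) * Complex.exp (Complex.I * ((-(l * u ^ 3) : ℝ) : ℂ))
        - Complex.exp (-b * (u : ℂ) ^ 2)
        - (-(Complex.I * l)) * ((u : ℂ) ^ 3 * Complex.exp (-b * (u : ℂ) ^ 2))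
      = Complex.exp (-b * (u : ℂ) ^ 2) * (Complex.exp (Complex.I * ((-(l * u ^ 3) : ℝ) : ℂ)) - 1
        - Complex.I * ((-(l * u ^ 3) : ℝ) : ℂ)) := by
    push_cast; ring
  rw [e2, norm_mul, norm_gauss]
  have t := cexp_taylor2 (-(l * u ^ 3))
  have p := pow_gauss_le 3 b.re u hb
  have f6 : ((Nat.factorial 3 : ℕ) : ℝ) = 6 := by norm_num [Nat.factorial]
  rw [f6] at p
  calc _ ≤ Real.exp (-b.re * u ^ 2) * (2 * (-(l * u ^ 3)) ^ 2) := by gcongr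
    _ = 2 * l ^ 2 * ((u ^ 2) ^ 3 * Real.exp (-b.re * u ^ 2)) := by ring
    _ ≤ 2 * l ^ 2 * (6 * 2 ^ 3 / b.re ^ 3 * Real.exp (-(b.re / 2) * u ^ 2)) := by gcongr
    _ = _ := by ring

lemma gauss_err1 (b : ℂ) (l : ℝ) (hb : 0 < b.re) :
    ‖∫ u : ℝ, (u : ℂ) * (Complex.exp (-b * (u : ℂ) ^ 2)
        * Complex.exp (Complex.I * ((-(l * u ^ 3) : ℝ) : ℂ)))‖
      ≤ 8 * |l| / b.re ^ 2 * √(π / (b.re / 2)) := by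
  have i1 := gauss_pow_integrable b 1 hb
  have iE : Integrable fun u : ℝ => (u : ℂ) * (Complex.exp (-b * (u : ℂ) ^ 2)
      * Complex.exp (Complex.I * ((-(l * u ^ 3) : ℝ) : ℂ))) := by
    refine Integrable.mono i1 (by fun_prop) (Filter.Eventually.of_forall fun u => ?_)
    rw [norm_mul, norm_mul, mul_comm Complex.I, Complex.norm_exp_ofReal_mul_I, mul_one, norm_mul,
      pow_one]
  have hodd : ∫ u : ℝ, ((u : ℂ) ^ 1 * Complex.exp (-b * (u : ℂ) ^ 2)) = 0 := by
    apply integral_odd_zero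
    intro u
    push_cast
    rw [show (-(u : ℂ)) ^ 2 = (u : ℂ) ^ 2 by ring]
    ring
  rw [← sub_zero (∫ u : ℝ, (u : ℂ) * _), ← hodd, ← integral_sub iE i1, ← integral_gaussian,
    ← integral_const_mul]
  refine norm_integral_le_of_norm_le ((integrable_exp_neg_mul_sq (half_pos hb)).const_mul _)
    (Filter.Eventually.of_forall fun u => ?_)
  have e2 : (u : ℂ) * (Complex.exp (-b * (u : ℂ) ^ 2) * Complex.exp (Complex.I * ((-(l * u ^ 3) : ℝ) : ℂ)))
        - (u : ℂ) ^ 1 * Complex.exp (-b * (u : ℂ) ^ 2)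
      = (u : ℂ) * (Complex.exp (-b * (u : ℂ) ^ 2)
        * (Complex.exp (Complex.I * ((-(l * u ^ 3) : ℝ) : ℂ)) - 1)) := by
    ring
  rw [e2, norm_mul, norm_mul, norm_gauss, Complex.norm_real, Real.norm_eq_abs]
  have t : ‖Complex.exp (Complex.I * ((-(l * u ^ 3) : ℝ) : ℂ)) - 1‖ ≤ |(-(l * u ^ 3))| :=
    norm_exp_I_mul_ofReal_sub_one_le
  have p := pow_gauss_le 2 b.re u hb
  have f6 : ((Nat.factorial 2 : ℕ) : ℝ) = 2 := by norm_num [Nat.factorial]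
  rw [f6] at p
  rw [abs_neg, abs_mul, abs_pow] at t
  calc _ ≤ |u| * (Real.exp (-b.re * u ^ 2) * (|l| * |u| ^ 3)) := by gcongr
    _ = |l| * ((|u| ^ 2) ^ 2 * Real.exp (-b.re * u ^ 2)) := by ring
    _ = |l| * ((u ^ 2) ^ 2 * Real.exp (-b.re * u ^ 2)) := by rw [sq_abs]
    _ ≤ |l| * (2 * 2 ^ 2 / b.re ^ 2 * Real.exp (-(b.re / 2) * u ^ 2)) := by gcongr
    _ = _ := by ring

lemma aiE_saddle (h : ℝ) (hh : 0 < h) (s : ℂ) (u : ℝ) :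
    aiE h (s ^ 2) (s + Complex.I * u) = Complex.exp (-(2 * s ^ 3) / (3 * h))
      * (Complex.exp (-(s / h) * (u : ℂ) ^ 2)
        * Complex.exp (Complex.I * ((-((1 / (3 * h)) * u ^ 3) : ℝ) : ℂ))) := by
  have hh' : (h : ℂ) ≠ 0 := by exact_mod_cast hh.ne'
  unfold aiE
  rw [← Complex.exp_add, ← Complex.exp_add]
  congr 1
  push_cast
  field_simp
  linear_combination (3 * s * (u : ℂ) ^ 2 + Complex.I * (u : ℂ) ^ 3) * Complex.I_sq

lemma gauss_val (h r q : ℝ) (hh : 0 < h) (hr : 0 < r) (hq : 0 < q) (hqr : q ^ 2 * r = 1)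
    (ρ ρ' : ℂ) (h1 : ρ * ρ' = 1) (hre : 0 < ρ'.re) :
    ((π : ℂ) / ((r * ρ ^ 2) / h)) ^ (1 / 2 : ℂ) = (√(π * h) : ℝ) * q * ρ' := by
  have hr' : (r : ℂ) ≠ 0 := by exact_mod_cast hr.ne'
  have hh' : (h : ℂ) ≠ 0 := by exact_mod_cast hh.ne'
  have hρ : ρ ≠ 0 := left_ne_zero_of_mul_eq_one h1
  have g2 : ((√(π * h) : ℝ) : ℂ) ^ 2 = π * h := by
    rw [← Complex.ofReal_pow, Real.sq_sqrt (by positivity)]; push_cast; rfl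
  have hqr' : (q : ℂ) ^ 2 * r = 1 := by exact_mod_cast hqr
  have e : (π : ℂ) / ((r * ρ ^ 2) / h) = ((√(π * h) : ℝ) * q * ρ') ^ 2 := by
    rw [mul_pow, mul_pow, g2]
    field_simp
    linear_combination -(ρ * ρ' + 1) * (q ^ 2 * r) * h1 - hqr'
  rw [e, one_div]
  apply Complex.sq_cpow_two_inv
  rw [← Complex.ofReal_mul, Complex.re_ofReal_mul]
  positivity

lemma saddle (h r q : ℝ) (hh : 0 < h) (hr : 2 / 5 ≤ r) (hr1 : r ≤ 1) (hq : 0 < q)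
    (hqr : q ^ 2 * r = 1)
    (ρ ρ' : ℂ) (h1 : ρ * ρ' = 1) (hre : 0 < ρ'.re) (hre2 : 1 / 2 ≤ (ρ ^ 2).re)
    (hn : ‖ρ‖ = 1) (hre6 : (ρ ^ 6).re = 0) :
    ‖aiA h ((r * ρ ^ 2) ^ 2) - Complex.exp (-(2 * (r * ρ ^ 2) ^ 3) / (3 * h))
        * ((√(π * h) : ℝ) * q * ρ')‖ ≤ 6000 * h * √(π * h) ∧
    ‖-(h : ℂ) * aiD h ((r * ρ ^ 2) ^ 2) - (r * ρ ^ 2) * (Complex.exp (-(2 * (r * ρ ^ 2) ^ 3) / (3 * h))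
        * ((√(π * h) : ℝ) * q * ρ'))‖ ≤ 7000 * h * √(π * h) := by
  have hr0 : 0 < r := by linarith
  have hh' : (h : ℂ) ≠ 0 := by exact_mod_cast hh.ne'
  rw [← gauss_val h r q hh hr0 hq hqr ρ ρ' h1 hre]
  set s : ℂ := r * ρ ^ 2 with hs
  have hsre : 1 / 5 ≤ s.re := by
    rw [hs, Complex.re_ofReal_mul]; nlinarith
  have hs0 : 0 < s.re := by linarith
  have hsn : ‖s‖ ≤ 1 := by
    rw [hs, norm_mul, norm_pow, hn, Complex.norm_real, Real.norm_eq_abs, abs_of_pos hr0]; linarith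
  have hb : (s / h).re = s.re / h := by rw [Complex.div_ofReal_re]
  have hbpos : 0 < (s / h).re := by rw [hb]; positivity
  rw [← integral_gaussian_complex hbpos]
  have hexp : ‖Complex.exp (-(2 * s ^ 3) / (3 * h))‖ = 1 := by
    rw [Complex.norm_exp]
    have : -(2 * s ^ 3) / (3 * (h : ℂ)) = ((-(2 * r ^ 3) / (3 * h) : ℝ) : ℂ) * ρ ^ 6 := by
      rw [hs]; push_cast; ring
    rw [this, Complex.re_ofReal_mul, hre6, mul_zero, Real.exp_zero]
  have g0 := gauss_err0 (s / h) (1 / (3 * h)) hbpos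
  have g1 := gauss_err1 (s / h) (1 / (3 * h)) hbpos
  have hble : 1 / (5 * h) ≤ (s / h).re := by
    rw [hb, div_le_div_iff₀ (by positivity) hh]; nlinarith
  have sqb : √(π / ((s / h).re / 2)) ≤ 4 * √(π * h) := by
    have e4 : √(4 ^ 2 * (π * h)) = 4 * √(π * h) := by
      rw [Real.sqrt_mul (by norm_num) (π * h), Real.sqrt_sq (by norm_num)]
    rw [← e4]
    apply Real.sqrt_le_sqrt
    rw [div_le_iff₀ (by positivity)]
    have : 1 / (5 * h) * (4 ^ 2 * (π * h) / 2) ≤ (s / h).re * (4 ^ 2 * (π * h) / 2) := by gcongr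
    have e : 1 / (5 * h) * (4 ^ 2 * (π * h) / 2) = 8 / 5 * π := by field_simp; norm_num
    have := Real.pi_pos
    nlinarith
  have g0' := g0.trans (b := _) (c := 6000 * h * √(π * h)) (by
    calc _ ≤ 96 * (1 / (3 * h)) ^ 2 / (1 / (5 * h)) ^ 3 * (4 * √(π * h)) := by gcongr
      _ = (16000 / 3) * h * √(π * h) := by field_simp; norm_num
      _ ≤ _ := by gcongr; norm_num)
  have g1' := g1.trans (b := _) (c := 1000 * h * √(π * h)) (by
    calc _ ≤ 8 * |1 / (3 * h)| / (1 / (5 * h)) ^ 2 * (4 * √(π * h)) := by gcongr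
      _ = (800 / 3) * h * √(π * h) := by rw [abs_of_pos (by positivity)]; field_simp; norm_num
      _ ≤ _ := by gcongr; norm_num)
  have i0 := aiI_integrable 0 h s (s ^ 2) hh hs0
  have A0 : aiA h (s ^ 2) = Complex.exp (-(2 * s ^ 3) / (3 * h)) *
      ∫ u : ℝ, Complex.exp (-(s / h) * (u : ℂ) ^ 2)
        * Complex.exp (Complex.I * ((-((1 / (3 * h)) * u ^ 3) : ℝ) : ℂ)) := by
    rw [aiA_eq h s (s ^ 2) hh hs0, aiI, ← integral_const_mul]
    congr 1; funext u
    rw [aiE_saddle h hh, pow_zero, one_mul]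
  have i1 := aiI_integrable 1 h s (s ^ 2) hh hs0
  have A1 : -(h : ℂ) * aiD h (s ^ 2) = s * aiA h (s ^ 2) + Complex.exp (-(2 * s ^ 3) / (3 * h)) *
      (Complex.I * ∫ u : ℝ, (u : ℂ) * (Complex.exp (-(s / h) * (u : ℂ) ^ 2)
        * Complex.exp (Complex.I * ((-((1 / (3 * h)) * u ^ 3) : ℝ) : ℂ)))) := by
    have : -(h : ℂ) * aiD h (s ^ 2) = aiI 1 h s (s ^ 2) := by
      rw [aiD_eq h s (s ^ 2) hh hs0]; field_simp
    rw [this, aiA_eq h s (s ^ 2) hh hs0, ← sub_eq_iff_eq_add', aiI, aiI, ← integral_const_mul,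
      ← integral_const_mul, ← integral_const_mul, ← integral_sub i1 (i0.const_mul _)]
    congr 1; funext u
    rw [aiE_saddle h hh, pow_zero, one_mul, pow_one]
    ring
  have B0 : ‖aiA h (s ^ 2) - Complex.exp (-(2 * s ^ 3) / (3 * h))
      * ∫ u : ℝ, Complex.exp (-(s / h) * (u : ℂ) ^ 2)‖ ≤ 6000 * h * √(π * h) := by
    rw [A0, ← mul_sub, norm_mul, hexp, one_mul]
    exact g0'
  refine ⟨B0, ?_⟩
  clear_value s
  rw [A1, add_sub_right_comm, ← mul_sub]
  refine (norm_add_le _ _).trans ?_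
  rw [norm_mul, norm_mul, hexp, one_mul, norm_mul, Complex.norm_I, one_mul]
  have := mul_le_mul hsn B0 (norm_nonneg _) zero_le_one
  linarith

lemma decay (h z : ℝ) (hh : 0 < h) (hh1 : h ≤ 1) (hz : 2 / 5 ≤ z) :
    ‖aiA h z‖ ≤ 4 * Real.exp (-(1 / 8) / h) * √(π * h) ∧
    ‖(h : ℂ) * aiD h z‖ ≤ 4 * Real.exp (-(1 / 8) / h) * √(π * h) := by
  have hh' : (h : ℂ) ≠ 0 := by exact_mod_cast hh.ne'
  have hc : 0 < ((1 / 2 : ℝ) : ℂ).re := by rw [Complex.ofReal_re]; norm_num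
  have e1 : (h : ℂ) * aiD h z = - aiI 1 h ((1 / 2 : ℝ) : ℂ) z := by
    rw [aiD_eq h ((1 / 2 : ℝ) : ℂ) z hh hc]; field_simp
  rw [e1, norm_neg, aiA_eq h ((1 / 2 : ℝ) : ℂ) z hh hc]
  have key : ∀ u : ℝ, ‖aiE h z (((1 / 2 : ℝ) : ℂ) + Complex.I * u)‖
      ≤ Real.exp (-(1 / 8) / h) * Real.exp (-(1 / (2 * h)) * u ^ 2) := by
    intro u
    rw [aiE_norm, ← Real.exp_add, Real.exp_le_exp, Complex.ofReal_re, Complex.ofReal_im,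
      Complex.ofReal_re, Complex.ofReal_im]
    have : -(1 / 8) / h + -(1 / (2 * h)) * u ^ 2 = (-(1 / 8) - u ^ 2 / 2) / h := by
      field_simp; ring
    rw [this]
    gcongr
    nlinarith
  have key2 : ∀ u : ℝ, (1 + |u|) * Real.exp (-(1 / (2 * h)) * u ^ 2)
      ≤ 2 * Real.exp (-(1 / (4 * h)) * u ^ 2) := by
    intro u
    have e : Real.exp (-(1 / (2 * h)) * u ^ 2)
        = Real.exp (-(1 / (4 * h)) * u ^ 2) * Real.exp (-(1 / (4 * h)) * u ^ 2) := by
      rw [← Real.exp_add]; congr 1; field_simp; ring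
    have e' : Real.exp (1 / (4 * h) * u ^ 2) * Real.exp (-(1 / (4 * h)) * u ^ 2) = 1 := by
      rw [← Real.exp_add]; ring_nf; simp
    have b0 : |u| ≤ Real.exp (1 / (4 * h) * u ^ 2) := by
      have := Real.add_one_le_exp (1 / (4 * h) * u ^ 2)
      have : 1 / 4 * u ^ 2 ≤ 1 / (4 * h) * u ^ 2 := by
        gcongr; linarith
      have : |u| ≤ 1 / 4 * u ^ 2 + 1 := by rw [← sq_abs]; nlinarith [sq_nonneg (|u| / 2 - 1)]
      linarith
    have b1 : 1 ≤ Real.exp (1 / (4 * h) * u ^ 2) := Real.one_le_exp (by positivity)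
    rw [e]
    calc _ ≤ (2 * Real.exp (1 / (4 * h) * u ^ 2)) * (Real.exp (-(1 / (4 * h)) * u ^ 2)
          * Real.exp (-(1 / (4 * h)) * u ^ 2)) := by gcongr; linarith
      _ = 2 * (Real.exp (1 / (4 * h) * u ^ 2) * Real.exp (-(1 / (4 * h)) * u ^ 2))
          * Real.exp (-(1 / (4 * h)) * u ^ 2) := by ring
      _ = _ := by rw [e']; ring
  have fin : ∫ u : ℝ, (2 * Real.exp (-(1 / 8) / h)) * Real.exp (-(1 / (4 * h)) * u ^ 2)
      = 4 * Real.exp (-(1 / 8) / h) * √(π * h) := by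
    rw [integral_const_mul, integral_gaussian]
    have : π / (1 / (4 * h)) = 2 ^ 2 * (π * h) := by field_simp; norm_num
    rw [this, Real.sqrt_mul (by norm_num), Real.sqrt_sq (by norm_num)]; ring
  have gen : ∀ k : ℕ, k ≤ 1 → ‖aiI k h ((1 / 2 : ℝ) : ℂ) z‖ ≤ 4 * Real.exp (-(1 / 8) / h) * √(π * h) := by
    intro k hk
    rw [← fin]
    refine norm_integral_le_of_norm_le ((integrable_exp_neg_mul_sq (by positivity)).const_mul _)
      (Filter.Eventually.of_forall fun u => ?_)
    rw [norm_mul, norm_pow]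
    have n1 : ‖((1 / 2 : ℝ) : ℂ) + Complex.I * u‖ ≤ 1 + |u| := by
      refine (norm_add_le _ _).trans ?_
      rw [Complex.norm_real, norm_mul, Complex.norm_I, Complex.norm_real]
      norm_num
    have n2 : ‖((1 / 2 : ℝ) : ℂ) + Complex.I * u‖ ^ k ≤ 1 + |u| := by
      interval_cases k
      · simp
      · simpa using n1
    calc _ ≤ (1 + |u|) * (Real.exp (-(1 / 8) / h) * Real.exp (-(1 / (2 * h)) * u ^ 2)) :=
          mul_le_mul n2 (key u) (norm_nonneg _) (by positivity)
      _ = Real.exp (-(1 / 8) / h) * ((1 + |u|) * Real.exp (-(1 / (2 * h)) * u ^ 2)) := by ring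
      _ ≤ Real.exp (-(1 / 8) / h) * (2 * Real.exp (-(1 / (4 * h)) * u ^ 2)) :=
          mul_le_mul_of_nonneg_left (key2 u) (Real.exp_pos _).le
      _ = _ := by ring
  exact ⟨gen 0 (by norm_num), gen 1 le_rfl⟩

lemma wkb_phase_val (V : ℝ → ℝ) (hV : ∀ x ∈ Set.Icc (2 : ℝ) 3.5, V x = 4 - x) (E x : ℝ)
    (hE : |E - 1| ≤ 1 / 50) (hx : x ∈ Set.Icc (3.25 : ℝ) 3.5) :
    wkbPhase V E x = 2 / 3 * √(x - (4 - E)) ^ 3 := by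
  rw [abs_le] at hE
  obtain ⟨hx1, hx2⟩ := hx
  norm_num at hx1 hx2
  have hY : 0 ≤ x - (4 - E) := by linarith [hE.1]
  have h1 : wkbPhase V E x = ∫ y in (4 - E)..x, √(y - (4 - E)) := by
    unfold wkbPhase
    apply intervalIntegral.integral_congr
    intro y hy
    rw [uIcc_of_le (by linarith [hE.1])] at hy
    simp only []
    rw [hV y ⟨by linarith [hy.1, hE.2], by norm_num; linarith [hy.2]⟩]
    congr 1; ring
  rw [h1, intervalIntegral.integral_comp_sub_right (fun t => √t) (4 - E), sub_self]
  simp_rw [Real.sqrt_eq_rpow]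
  rw [integral_rpow (Or.inl (by norm_num)), ← Real.rpow_natCast, ← Real.rpow_mul hY]
  norm_num
  ring

lemma wkb_deriv (V : ℝ → ℝ) (hVs : ContDiff ℝ (⊤ : ℕ∞) V)
    (hV : ∀ x ∈ Set.Icc (2 : ℝ) 3.5, V x = 4 - x) (h E x : ℝ) (σ : ℂ)
    (hE : |E - 1| ≤ 1 / 50) (hx : x ∈ Set.Icc (3.25 : ℝ) 3.5) :
    HasDerivAt (fun x => (((E - V x) ^ (-(1 / 4 : ℝ)) : ℝ) : ℂ)
        * Complex.exp (σ * (wkbPhase V E x) / h))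
      (((-(1 / 4) * (x - (4 - E)) ^ (-(5 / 4 : ℝ)) : ℝ) : ℂ) * Complex.exp (σ * (wkbPhase V E x) / h)
        + (((x - (4 - E)) ^ (-(1 / 4 : ℝ)) : ℝ) : ℂ)
          * (Complex.exp (σ * (wkbPhase V E x) / h) * (σ * √(x - (4 - E)) / h))) x := by
  rw [abs_le] at hE
  obtain ⟨hx1, hx2⟩ := hx
  norm_num at hx1 hx2
  have hY : 0 < x - (4 - E) := by linarith [hE.1]
  have hx3 : x ∈ Set.Icc (2 : ℝ) 3.5 := ⟨by linarith, by norm_num; linarith⟩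
  have e : E - V x = x - (4 - E) := by rw [hV x hx3]; ring
  have hd : HasDerivAt V (-1) x := by
    have h1 : HasDerivAt V (deriv V x) x := (hVs.differentiable (by simp) x).hasDerivAt
    have h2 : HasDerivWithinAt V (-1) (Set.Icc (2 : ℝ) 3.5) x := by
      have : HasDerivWithinAt (fun x : ℝ => 4 - x) (-1) (Set.Icc (2 : ℝ) 3.5) x :=
        ((hasDerivAt_id x).const_sub 4).hasDerivWithinAt
      exact this.congr hV (hV x hx3)
    have h3 := (uniqueDiffOn_Icc (by norm_num : (2 : ℝ) < 3.5) x hx3).eq_deriv _ h1.hasDerivWithinAt h2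
    rwa [h3] at h1
  have hp : HasDerivAt (wkbPhase V E) (√(x - (4 - E))) x := by
    have := (Continuous.integral_hasStrictDerivAt
      (f := fun y => √(E - V y)) (by have := hVs.continuous; fun_prop) (4 - E) x).hasDerivAt
    rw [← e]
    exact this
  have ha : HasDerivAt (fun x => (E - V x) ^ (-(1 / 4 : ℝ)))
      (-(1 / 4) * (x - (4 - E)) ^ (-(5 / 4 : ℝ))) x := by
    have h1 : HasDerivAt (fun x => E - V x) 1 x := by simpa using hd.const_sub E
    have := h1.rpow_const (p := -(1 / 4 : ℝ)) (Or.inl (by rw [e]; exact hY.ne'))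
    refine this.congr_deriv ?_
    rw [e, one_mul]
    congr 2; norm_num
  have hpc : HasDerivAt (fun x => Complex.exp (σ * (wkbPhase V E x) / h))
      (Complex.exp (σ * (wkbPhase V E x) / h) * (σ * √(x - (4 - E)) / h)) x :=
    ((hp.ofReal_comp.const_mul σ).div_const (h : ℂ)).cexp
  have := ha.ofReal_comp.mul hpc
  rw [← e] at this ⊢
  exact this

lemma rho_facts : ∃ ρ ρ' : ℂ, ρ * ρ' = 1 ∧ ρ ^ 6 = Complex.I ∧ ρ' ^ 6 = -Complex.I ∧
    ρ ^ 4 + ρ' ^ 4 = 1 ∧ ‖ρ‖ = 1 ∧ ‖ρ'‖ = 1 ∧ 0 < ρ.re ∧ 0 < ρ'.re ∧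
    1 / 2 ≤ (ρ ^ 2).re ∧ 1 / 2 ≤ (ρ' ^ 2).re ∧
    Complex.exp (Complex.I * (Real.pi / 4)) = ρ ^ 3 ∧
    Complex.exp (-Complex.I * (Real.pi / 4)) = ρ' ^ 3 := by
  have pw : ∀ (n : ℕ) (t : ℝ), Complex.exp (t * Complex.I) ^ n = Complex.exp ((n * t : ℝ) * Complex.I) := by
    intro n t
    rw [← Complex.exp_nat_mul]; push_cast; ring_nf
  have pr : ∀ t : ℝ, (Complex.exp (t * Complex.I)).re = Real.cos t := Complex.exp_ofReal_mul_I_re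
  have s3 : 1 ≤ √3 := by rw [Real.one_le_sqrt]; norm_num
  have pp := Real.pi_pos
  refine ⟨Complex.exp ((π / 12 : ℝ) * Complex.I), Complex.exp ((-(π / 12) : ℝ) * Complex.I),
    ?_, ?_, ?_, ?_, Complex.norm_exp_ofReal_mul_I _, Complex.norm_exp_ofReal_mul_I _, ?_, ?_, ?_, ?_, ?_, ?_⟩
  · rw [← Complex.exp_add, ← add_mul, ← Complex.ofReal_add]; simp
  · rw [pw, show ((6 : ℕ) : ℝ) * (π / 12) = π / 2 by push_cast; ring]
    push_cast; exact Complex.exp_pi_div_two_mul_I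
  · rw [pw, show ((6 : ℕ) : ℝ) * (-(π / 12)) = -(π / 2) by push_cast; ring]
    push_cast; rw [neg_mul, Complex.exp_neg, Complex.exp_pi_div_two_mul_I, Complex.inv_I]
  · rw [pw, pw, show ((4 : ℕ) : ℝ) * (π / 12) = π / 3 by push_cast; ring,
      show ((4 : ℕ) : ℝ) * (-(π / 12)) = -(π / 3) by push_cast; ring]
    apply Complex.ext
    · rw [Complex.add_re, pr, pr, Real.cos_neg, Real.cos_pi_div_three]; norm_num
    · rw [Complex.add_im, Complex.exp_ofReal_mul_I_im, Complex.exp_ofReal_mul_I_im, Real.sin_neg]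
      simp
  · rw [pr]; exact Real.cos_pos_of_mem_Ioo ⟨by linarith, by linarith⟩
  · rw [pr]; exact Real.cos_pos_of_mem_Ioo ⟨by linarith, by linarith⟩
  · rw [pw, pr, show ((2 : ℕ) : ℝ) * (π / 12) = π / 6 by push_cast; ring, Real.cos_pi_div_six]; linarith
  · rw [pw, pr, show ((2 : ℕ) : ℝ) * (-(π / 12)) = -(π / 6) by push_cast; ring, Real.cos_neg,
      Real.cos_pi_div_six]; linarith
  · rw [pw]; congr 1; push_cast; ring
  · rw [pw]; congr 1; push_cast; ring

/-- Asymptotics of the Airy-type function in the oscillatory region. -/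
lemma airy_osc (h y : ℝ) (hh : 0 < h) (hy : 4 / 25 ≤ y) (hy1 : y ≤ 1) (e₁ e₂ : ℂ)
    (he₁ : e₁ = Complex.exp (Complex.I * ((2 / 3 * √y ^ 3 : ℝ) : ℂ) / h))
    (he₂ : e₂ = Complex.exp (-Complex.I * ((2 / 3 * √y ^ 3 : ℝ) : ℂ) / h)) :
    ‖(Complex.I / (√(π * h) : ℝ)) * aiA h (-y)
      - (Complex.exp (Complex.I * (Real.pi / 4)) * ((y ^ (-(1 / 4 : ℝ)) : ℝ) * e₁)
        - Complex.exp (-Complex.I * (Real.pi / 4)) * ((y ^ (-(1 / 4 : ℝ)) : ℝ) * e₂))‖ ≤ 12000 * h ∧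
    ‖-(Complex.I / (√(π * h) : ℝ)) * (h * aiD h (-y))
      - (Complex.exp (Complex.I * (Real.pi / 4)) * ((y ^ (-(1 / 4 : ℝ)) : ℝ) * (e₁ * (Complex.I * √y)))
        - Complex.exp (-Complex.I * (Real.pi / 4))
          * ((y ^ (-(1 / 4 : ℝ)) : ℝ) * (e₂ * (-Complex.I * √y))))‖ ≤ 14000 * h := by
  obtain ⟨ρ, ρ', h1, h6, h6', h4, n, n', re, re', re2, re2', hp, hm⟩ := rho_facts
  rw [hp, hm]
  have y0 : 0 < y := by linarith
  set r := √y with hr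
  have hr2 : r ^ 2 = y := Real.sq_sqrt y0.le
  have hr5 : 2 / 5 ≤ r := Real.le_sqrt_of_sq_le (by norm_num; linarith)
  have hr1 : r ≤ 1 := Real.sqrt_le_one.mpr hy1
  set q : ℝ := y ^ (-(1 / 4 : ℝ)) with hq
  have hq0 : 0 < q := Real.rpow_pos_of_pos y0 _
  have hqr : q ^ 2 * r = 1 := by
    rw [hq, hr, Real.sqrt_eq_rpow, ← Real.rpow_natCast, ← Real.rpow_mul y0.le, ← Real.rpow_add y0]
    norm_num
  have hg0 : 0 < √(π * h) := Real.sqrt_pos.mpr (by positivity)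
  set g := √(π * h) with hg
  have gC : (g : ℂ) ≠ 0 := by exact_mod_cast hg0.ne'
  have hh' : (h : ℂ) ≠ 0 := by exact_mod_cast hh.ne'
  obtain ⟨a1, a2⟩ := saddle h r q hh hr5 hr1 hq0 hqr ρ ρ' h1 re' re2 n (by rw [h6]; simp)
  obtain ⟨b1, b2⟩ := saddle h r q hh hr5 hr1 hq0 hqr ρ' ρ (by rw [mul_comm]; exact h1) re re2' n'
    (by rw [h6']; simp)
  have ea : Complex.exp (-(2 * (r * ρ ^ 2) ^ 3) / (3 * h)) = e₂ := by
    rw [he₂]; congr 1; push_cast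
    rw [mul_pow, ← pow_mul, h6]; ring
  have eb : Complex.exp (-(2 * (r * ρ' ^ 2) ^ 3) / (3 * h)) = e₁ := by
    rw [he₁]; congr 1; push_cast
    rw [mul_pow, ← pow_mul, h6']; ring
  have yC : (y : ℂ) = (r : ℂ) ^ 2 := by rw [← hr2]; push_cast; rfl
  have za : ((r : ℂ) * ρ ^ 2) ^ 2 = ρ ^ 4 * y := by rw [yC]; ring
  have zb : ((r : ℂ) * ρ' ^ 2) ^ 2 = ρ' ^ 4 * y := by rw [yC]; ring
  rw [ea, za] at a1 a2
  rw [eb, zb] at b1 b2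
  have I2 := Complex.I_sq
  have h12 : ρ ^ 12 = -1 := by linear_combination (ρ ^ 6 + Complex.I) * h6 + I2
  have h12' : ρ' ^ 12 = -1 := by linear_combination (ρ' ^ 6 - Complex.I) * h6' + I2
  obtain ⟨c1, c2⟩ := aiA_rot h y hh y0.le (ρ ^ 4) (ρ' ^ 4) h4
    (by
      have : ρ ^ 4 * ρ' ^ 4 = 1 := by rw [← mul_pow, h1, one_pow]
      linear_combination (ρ ^ 4 + ρ' ^ 4 + 1) * h4 - 2 * this)
    (by rw [← pow_mul]; exact h12) (by rw [← pow_mul]; exact h12')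
  -- phase identities
  have p1 : Complex.I * ρ ^ 4 * ρ' = -ρ' ^ 3 := by
    have : ρ ^ 4 * ρ' ^ 4 = 1 := by rw [← mul_pow, h1, one_pow]
    have t : ρ ^ 4 * ρ' = ρ ^ 3 := by linear_combination ρ ^ 3 * h1
    have t3 : ρ ^ 3 * ρ' ^ 3 = 1 := by rw [← mul_pow, h1, one_pow]
    rw [mul_assoc, t]
    linear_combination ρ' ^ 3 * h12 - ρ ^ 9 * t3 - ρ ^ 3 * h6
  have p2 : Complex.I * ρ' ^ 4 * ρ = ρ ^ 3 := by
    have t : ρ' ^ 4 * ρ = ρ' ^ 3 := by linear_combination ρ' ^ 3 * h1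
    have t3 : ρ ^ 3 * ρ' ^ 3 = 1 := by rw [← mul_pow, h1, one_pow]
    rw [mul_assoc, t]
    linear_combination ρ ^ 3 * t3 - ρ' ^ 3 * h6
  have p3 : (ρ ^ 4) ^ 2 * ρ ^ 2 * ρ' = -ρ' ^ 3 := by
    have t3 : ρ ^ 3 * ρ' ^ 3 = 1 := by rw [← mul_pow, h1, one_pow]
    linear_combination ρ ^ 9 * h1 - ρ ^ 9 * t3 + ρ' ^ 3 * h12
  have p4 : (ρ' ^ 4) ^ 2 * ρ' ^ 2 * ρ = -ρ ^ 3 := by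
    have t3 : ρ ^ 3 * ρ' ^ 3 = 1 := by rw [← mul_pow, h1, one_pow]
    linear_combination ρ' ^ 9 * h1 - ρ' ^ 9 * t3 + ρ ^ 3 * h12'
  have nI : ‖Complex.I / (g : ℂ)‖ = 1 / g := by
    rw [norm_div, Complex.norm_I, Complex.norm_real, Real.norm_eq_abs, abs_of_pos hg0]
  constructor
  · have e : (Complex.I / (g : ℂ)) * aiA h (-y) - (ρ ^ 3 * (q * e₁) - ρ' ^ 3 * (q * e₂))
        = (Complex.I / (g : ℂ)) * (ρ ^ 4 * (aiA h (ρ ^ 4 * y) - e₂ * (g * q * ρ'))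
          + ρ' ^ 4 * (aiA h (ρ' ^ 4 * y) - e₁ * (g * q * ρ))) := by
      rw [c1]
      field_simp
      linear_combination (g * q * e₂) * p1 + (g * q * e₁) * p2
    rw [e, norm_mul, nI]
    have := norm_add_le (ρ ^ 4 * (aiA h (ρ ^ 4 * y) - e₂ * (g * q * ρ')))
      (ρ' ^ 4 * (aiA h (ρ' ^ 4 * y) - e₁ * (g * q * ρ)))
    rw [norm_mul, norm_mul, norm_pow, norm_pow, n, n', one_pow, one_mul, one_mul] at this
    rw [one_div, inv_mul_le_iff₀ hg0]
    linarith
  · have e : -(Complex.I / (g : ℂ)) * (h * aiD h (-y)) - (ρ ^ 3 * (q * (e₁ * (Complex.I * r)))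
          - ρ' ^ 3 * (q * (e₂ * (-Complex.I * r))))
        = -(Complex.I / (g : ℂ)) * ((ρ ^ 4) ^ 2 * (-(h : ℂ) * aiD h (ρ ^ 4 * y) - r * ρ ^ 2 * (e₂ * (g * q * ρ')))
          + (ρ' ^ 4) ^ 2 * (-(h : ℂ) * aiD h (ρ' ^ 4 * y) - r * ρ' ^ 2 * (e₁ * (g * q * ρ)))) := by
      have c2' : aiD h (-y) = -((ρ ^ 4) ^ 2 * aiD h (ρ ^ 4 * y) + (ρ' ^ 4) ^ 2 * aiD h (ρ' ^ 4 * y)) := by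
        rw [← c2, neg_neg]
      rw [c2']
      field_simp
      linear_combination (-g * q * e₂ * r) * p3 - (g * q * e₁ * r) * p4
    rw [e, norm_mul, norm_neg, nI]
    have := norm_add_le ((ρ ^ 4) ^ 2 * (-(h : ℂ) * aiD h (ρ ^ 4 * y) - r * ρ ^ 2 * (e₂ * (g * q * ρ'))))
      ((ρ' ^ 4) ^ 2 * (-(h : ℂ) * aiD h (ρ' ^ 4 * y) - r * ρ' ^ 2 * (e₁ * (g * q * ρ))))
    rw [norm_mul, norm_mul, norm_pow, norm_pow, norm_pow, norm_pow, n, n', one_pow, one_pow, one_mul,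
      one_mul] at this
    rw [one_div, inv_mul_le_iff₀ hg0]
    linarith

/-- (Airy function near the turning point.) There exists a solution `w` of
`-h²w'' + (4 - x - E₀)w = 0` on `[2, 3.5]` that is exponentially small in `H¹_h(2, 2.5)` and
satisfies `(w, h w') = e^{iπ/4}(v₊, h v₊') - e^{-iπ/4}(v₋, h v₋') + O(h)` on `[3.25, 3.5]`. -/
theorem airy_connection_solution
    (V : ℝ → ℝ)
    (hV_smooth : ContDiff ℝ (⊤ : ℕ∞) V) (hV_comp : HasCompactSupport V)
    (hV_nonneg : ∀ x, 0 ≤ V x) (hV_even : ∀ x, V (-x) = V x)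
    (hV_inner : ∀ x ∈ Set.Icc (-1 : ℝ) 1, V x = x ^ 2 + 1)
    (hV_slope : ∀ x ∈ Set.Icc (2 : ℝ) 3.5, V x = 4 - x)
    (hV_lt : ∀ x : ℝ, 3 < x → V x < 1)
    (hV_supp : tsupport V ⊆ Set.Icc (-5 : ℝ) 5)
    (R : ℝ) (hR : 5 < R) :
    ∃ C > (0 : ℝ), ∃ c > (0 : ℝ), ∃ h₀ > (0 : ℝ), ∀ h : ℝ, 0 < h → h < h₀ →
      ∀ E₀ : ℝ, |E₀ - (1 + h)| ≤ Real.exp (-1 / (10 * h)) →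
      ∃ w : ℝ → ℂ,
        ContDiff ℝ (⊤ : ℕ∞) w ∧
        (∀ x ∈ Set.Icc (2 : ℝ) 3.5,
          -(h : ℂ) ^ 2 * deriv (deriv w) x + ((4 - x - E₀ : ℝ) : ℂ) * w x = 0) ∧
        Real.sqrt ((∫ x in Set.Ioo (2 : ℝ) 2.5, ‖w x‖ ^ 2)
            + ∫ x in Set.Ioo (2 : ℝ) 2.5, ‖(h : ℂ) * deriv w x‖ ^ 2)
          ≤ C * Real.exp (-c / h) ∧
        (∀ x ∈ Set.Icc (3.25 : ℝ) 3.5,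
          ‖w x - (Complex.exp (Complex.I * (Real.pi / 4)) * wkbPlus V h E₀ x
              - Complex.exp (-Complex.I * (Real.pi / 4)) * wkbMinus V h E₀ x)‖ ≤ C * h ∧
          ‖(h : ℂ) * deriv w x
              - (Complex.exp (Complex.I * (Real.pi / 4)) * ((h : ℂ) * deriv (wkbPlus V h E₀) x)
                - Complex.exp (-Complex.I * (Real.pi / 4))
                  * ((h : ℂ) * deriv (wkbMinus V h E₀) x))‖ ≤ C * h) := by
  refine ⟨30000, by norm_num, 1 / 8, by norm_num, 1 / 1000, by norm_num, ?_⟩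
  intro h hh hh0 E hE
  have hh' : (h : ℂ) ≠ 0 := by exact_mod_cast hh.ne'
  have hE1 : |E - 1| ≤ 1 / 50 := by
    have h1 : Real.exp (-1 / (10 * h)) ≤ 10 * h := by
      rw [neg_div, Real.exp_neg]
      have h2 := Real.add_one_le_exp (1 / (10 * h))
      have h3 : 1 / (10 * h) ≤ Real.exp (1 / (10 * h)) := by linarith
      have := inv_anti₀ (by positivity) h3
      simpa using this
    have := abs_le.mp (hE.trans h1)
    rw [abs_le]
    constructor <;> linarith [this.1, this.2]
  have hE2 := abs_le.mp hE1
  set g := √(π * h) with hg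
  have hg0 : 0 < g := Real.sqrt_pos.mpr (by positivity)
  have gC : (g : ℂ) ≠ 0 := by exact_mod_cast hg0.ne'
  have nI : ‖Complex.I / (g : ℂ)‖ = 1 / g := by
    rw [norm_div, Complex.norm_I, Complex.norm_real, Real.norm_eq_abs, abs_of_pos hg0]
  have hlin : ∀ x : ℝ, HasDerivAt (fun x : ℝ => ((4 - E - x : ℝ) : ℂ)) (-1) x := by
    intro x
    have := ((hasDerivAt_id x).const_sub (4 - E)).ofReal_comp
    simpa using this
  have hw1 : ∀ x : ℝ, HasDerivAt (fun x : ℝ => (Complex.I / (g : ℂ)) * aiA h ((4 - E - x : ℝ) : ℂ))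
      (-(Complex.I / (g : ℂ)) * aiD h ((4 - E - x : ℝ) : ℂ)) x := by
    intro x
    have := ((aiA_hasDerivAt h ((4 - E - x : ℝ) : ℂ) hh).comp x (hlin x)).const_mul
      (Complex.I / (g : ℂ))
    exact this.congr_deriv (by ring)
  have hw2 : ∀ x : ℝ, HasDerivAt (fun x : ℝ => -(Complex.I / (g : ℂ)) * aiD h ((4 - E - x : ℝ) : ℂ))
      ((Complex.I / (g : ℂ)) * (((4 - E - x : ℝ) : ℂ) * aiA h ((4 - E - x : ℝ) : ℂ) / h ^ 2)) x := by
    intro x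
    have := ((aiD_hasDerivAt h ((4 - E - x : ℝ) : ℂ) hh).comp x (hlin x)).const_mul
      (-(Complex.I / (g : ℂ)))
    exact this.congr_deriv (by ring)
  have dw : deriv (fun x : ℝ => (Complex.I / (g : ℂ)) * aiA h ((4 - E - x : ℝ) : ℂ))
      = fun x : ℝ => -(Complex.I / (g : ℂ)) * aiD h ((4 - E - x : ℝ) : ℂ) :=
    funext fun x => (hw1 x).deriv
  refine ⟨fun x : ℝ => (Complex.I / (g : ℂ)) * aiA h ((4 - E - x : ℝ) : ℂ), ?_, ?_, ?_, ?_⟩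
  · have hA : ContDiff ℂ (⊤ : ℕ∞) (aiA h) := by
      have : Differentiable ℂ (aiA h) := fun z => (aiA_hasDerivAt h z hh).differentiableAt
      exact this.contDiff
    have hA' : ContDiff ℝ (⊤ : ℕ∞) (aiA h) := hA.restrict_scalars ℝ
    have hl : ContDiff ℝ (⊤ : ℕ∞) (fun x : ℝ => ((4 - E - x : ℝ) : ℂ)) :=
      Complex.ofRealCLM.contDiff.comp (contDiff_const.sub contDiff_id)
    exact contDiff_const.mul (hA'.comp hl)
  · intro x _
    rw [dw, (hw2 x).deriv]
    have : ((4 - x - E : ℝ) : ℂ) = ((4 - E - x : ℝ) : ℂ) := by congr 1; ring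
    rw [this]
    field_simp
    ring
  · rw [dw]
    have key : ∀ x ∈ Set.Ioo (2 : ℝ) 2.5, ‖(Complex.I / (g : ℂ)) * aiA h ((4 - E - x : ℝ) : ℂ)‖
          ≤ 4 * Real.exp (-(1 / 8) / h) ∧
        ‖(h : ℂ) * (-(Complex.I / (g : ℂ)) * aiD h ((4 - E - x : ℝ) : ℂ))‖
          ≤ 4 * Real.exp (-(1 / 8) / h) := by
      intro x hx
      have hx2 := hx.2
      norm_num at hx2
      obtain ⟨d1, d2⟩ := decay h (4 - E - x) hh (by linarith) (by linarith [hE2.2])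
      constructor
      · rw [norm_mul, nI, one_div, inv_mul_le_iff₀ hg0]
        linarith
      · rw [show (h : ℂ) * (-(Complex.I / (g : ℂ)) * aiD h ((4 - E - x : ℝ) : ℂ))
          = -(Complex.I / (g : ℂ)) * (h * aiD h ((4 - E - x : ℝ) : ℂ)) by ring, norm_mul, norm_neg,
          nI, one_div, inv_mul_le_iff₀ hg0]
        linarith
    set m := 4 * Real.exp (-(1 / 8) / h) with hm
    have m0 : 0 ≤ m := by positivity
    have ib : ∀ f : ℝ → ℂ, (∀ x ∈ Set.Ioo (2 : ℝ) 2.5, ‖f x‖ ≤ m) →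
        ∫ x in Set.Ioo (2 : ℝ) 2.5, ‖f x‖ ^ 2 ≤ m ^ 2 := by
      intro f hf
      have := norm_setIntegral_le_of_norm_le_const (μ := volume) (s := Set.Ioo (2 : ℝ) 2.5)
        (f := fun x => ‖f x‖ ^ 2) (C := m ^ 2) (by simp) (by
          intro x hx
          rw [norm_pow, norm_norm]
          have := hf x hx
          gcongr)
      have h2 := (le_abs_self _).trans this
      have h3 : (volume : Measure ℝ).real (Set.Ioo (2 : ℝ) 2.5) = 1 / 2 := by
        rw [Real.volume_real_Ioo]; norm_num
      rw [h3] at h2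
      nlinarith [sq_nonneg m]
    have i1 := ib _ fun x hx => (key x hx).1
    have i2 := ib _ fun x hx => (key x hx).2
    have e0 := Real.exp_pos (-(1 / 8) / h)
    refine Real.sqrt_le_iff.mpr ⟨by positivity, ?_⟩
    refine (add_le_add i1 i2).trans ?_
    rw [hm]
    nlinarith [sq_nonneg (Real.exp (-(1 / 8) / h))]
  · intro x hx
    have hx1 := hx.1
    have hx2 := hx.2
    norm_num at hx1 hx2
    rw [dw]
    have dp := (wkb_deriv V hV_smooth hV_slope h E x Complex.I hE1 hx).deriv
    have dm := (wkb_deriv V hV_smooth hV_slope h E x (-Complex.I) hE1 hx).deriv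
    have ph := wkb_phase_val V hV_slope E x hE1 hx
    have hx3 : x ∈ Set.Icc (2 : ℝ) 3.5 := ⟨by linarith, by norm_num; linarith⟩
    have e : E - V x = x - (4 - E) := by rw [hV_slope x hx3]; ring
    have dp' : deriv (wkbPlus V h E) x = _ := dp
    have dm' : deriv (wkbMinus V h E) x = _ := dm
    rw [dp', dm']
    have vp : wkbPlus V h E x = (((x - (4 - E)) ^ (-(1 / 4 : ℝ)) : ℝ) : ℂ)
        * Complex.exp (Complex.I * (wkbPhase V E x) / h) := by unfold wkbPlus; rw [e]
    have vm : wkbMinus V h E x = (((x - (4 - E)) ^ (-(1 / 4 : ℝ)) : ℝ) : ℂ)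
        * Complex.exp (-Complex.I * (wkbPhase V E x) / h) := by unfold wkbMinus; rw [e]
    rw [vp, vm, ph]
    have hz : ((4 - E - x : ℝ) : ℂ) = -((x - (4 - E) : ℝ) : ℂ) := by push_cast; ring
    simp only [hz]
    set y := x - (4 - E) with hy
    have y1 : 1 / 5 ≤ y := by linarith [hE2.1]
    have y2 : y ≤ 1 := by linarith [hE2.2]
    obtain ⟨o1, o2⟩ := airy_osc h y hh (by linarith) y2 _ _ rfl rfl
    set e₁ := Complex.exp (Complex.I * ((2 / 3 * √y ^ 3 : ℝ) : ℂ) / h) with he₁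
    set e₂ := Complex.exp (-Complex.I * ((2 / 3 * √y ^ 3 : ℝ) : ℂ) / h) with he₂
    have n1 : ‖e₁‖ = 1 := by
      rw [he₁, show Complex.I * ((2 / 3 * √y ^ 3 : ℝ) : ℂ) / h
        = ((2 / 3 * √y ^ 3 / h : ℝ) : ℂ) * Complex.I by push_cast; ring]
      exact Complex.norm_exp_ofReal_mul_I _
    have n2 : ‖e₂‖ = 1 := by
      rw [he₂, show -Complex.I * ((2 / 3 * √y ^ 3 : ℝ) : ℂ) / h
        = ((-(2 / 3 * √y ^ 3 / h) : ℝ) : ℂ) * Complex.I by push_cast; ring]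
      exact Complex.norm_exp_ofReal_mul_I _
    refine ⟨o1.trans (by linarith), ?_⟩
    have np : ‖Complex.exp (Complex.I * (Real.pi / 4))‖ = 1 := by
      rw [show Complex.I * ((π : ℂ) / 4) = ((π / 4 : ℝ) : ℂ) * Complex.I by push_cast; ring]
      exact Complex.norm_exp_ofReal_mul_I _
    have nm : ‖Complex.exp (-Complex.I * (Real.pi / 4))‖ = 1 := by
      rw [show -Complex.I * ((π : ℂ) / 4) = ((-(π / 4) : ℝ) : ℂ) * Complex.I by push_cast; ring]
      exact Complex.norm_exp_ofReal_mul_I _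
    set P := Complex.exp (Complex.I * (Real.pi / 4))
    set M := Complex.exp (-Complex.I * (Real.pi / 4))
    set q := y ^ (-(1 / 4 : ℝ))
    have y54 : y ^ (-(5 / 4 : ℝ)) ≤ 25 := by
      have h1 : y ^ (-(5 / 4 : ℝ)) ≤ y ^ (-2 : ℝ) :=
        Real.rpow_le_rpow_of_exponent_ge (by linarith) y2 (by norm_num)
      have h2 : y ^ (-2 : ℝ) = (y ^ 2)⁻¹ := by
        rw [Real.rpow_neg (by linarith)]; norm_num
      have h3 : (y ^ 2)⁻¹ ≤ ((1 / 5 : ℝ) ^ 2)⁻¹ := inv_anti₀ (by norm_num) (by gcongr)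
      rw [h2] at h1
      norm_num at h3
      linarith
    have y54' : 0 ≤ y ^ (-(5 / 4 : ℝ)) := Real.rpow_nonneg (by linarith) _
    set k := y ^ (-(5 / 4 : ℝ))
    have split : (h : ℂ) * (-(Complex.I / (g : ℂ)) * aiD h (-(y : ℂ)))
        - (P * ((h : ℂ) * (((-(1 / 4) * k : ℝ) : ℂ) * e₁ + (q : ℂ) * (e₁ * (Complex.I * (√y : ℝ) / h))))
          - M * ((h : ℂ) * (((-(1 / 4) * k : ℝ) : ℂ) * e₂
            + (q : ℂ) * (e₂ * (-Complex.I * (√y : ℝ) / h)))))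
        = (-(Complex.I / (g : ℂ)) * (h * aiD h (-(y : ℂ)))
          - (P * (q * (e₁ * (Complex.I * (√y : ℝ)))) - M * (q * (e₂ * (-Complex.I * (√y : ℝ))))))
          + ((h / 4 * k : ℝ) : ℂ) * (P * e₁ - M * e₂) := by
      push_cast
      field_simp
      ring
    rw [split]
    refine (norm_add_le _ _).trans ?_
    have t : ‖((h / 4 * k : ℝ) : ℂ) * (P * e₁ - M * e₂)‖ ≤ (h / 4 * 25) * 2 := by
      rw [norm_mul, Complex.norm_real, Real.norm_eq_abs, abs_of_nonneg (by positivity)]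
      have : ‖P * e₁ - M * e₂‖ ≤ 2 := by
        refine (norm_sub_le _ _).trans ?_
        rw [norm_mul, norm_mul, np, nm, n1, n2]; norm_num
      gcongr
    linarith
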